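/- Under the stated assumptions on d, φ, J and κ, the good heat kernel for L^κ is unique: if p and q are both good heat kernels for L^κ, then p(t,x,y) = q(t,x,y) for all t > 0 and x, y ∈ ℝ^d. -/

import Mathlib

open MeasureTheory Filter Set

attribute [local instance] Classical.propDecidable

noncomputable def Phi (φ : ℝ → ℝ) (r : ℝ) : ℝ :=
  if r ≤ 1 then r ^ 2 / (2 * ∫ s in Set.Ioo (0:ℝ) r, s / φ s)
  else (1 / (2 * ∫ s in Set.Ioo (0:ℝ) 1, s / φ s)) * r ^ 2

noncomputable def theta (d : ℕ) (φ : ℝ → ℝ) (b β : ℝ) (r : ℝ) : ℝ :=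
  if r ≤ 1 then 1 / (r ^ d * Phi φ r)
  else if β < 1 then Real.exp (-b * r ^ β)
  else r ^ (-(d : ℝ) - 1) * Real.exp (-(b / 5) * r)

noncomputable def Gfun (d : ℕ) (φ : ℝ → ℝ) (b β : ℝ) (Φinv : ℝ → ℝ)
    (t : ℝ) (x : EuclideanSpace ℝ (Fin d)) : ℝ :=
  if x = 0 then 1 / (t * Φinv t ^ d)
  else min (1 / (t * Φinv t ^ d)) (theta d φ b β ‖x‖)

noncomputable def Gtil (d : ℕ) (φ : ℝ → ℝ) (Φinv : ℝ → ℝ)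
    (t : ℝ) (x : EuclideanSpace ℝ (Fin d)) : ℝ :=
  if x = 0 then 1 / (t * Φinv t ^ d)
  else min (1 / (t * Φinv t ^ d)) (1 / (‖x‖ ^ d * Phi φ ‖x‖))

noncomputable def Leps (d : ℕ)
    (κ : EuclideanSpace ℝ (Fin d) → EuclideanSpace ℝ (Fin d) → ℝ) (J : ℝ → ℝ)
    (ε : ℝ) (f : EuclideanSpace ℝ (Fin d) → ℝ) (x : EuclideanSpace ℝ (Fin d)) : ℝ :=
  ∫ z in {z : EuclideanSpace ℝ (Fin d) | ε < ‖z‖}, (f (x + z) - f x) * (κ x z * J ‖z‖)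

structure PhiInvSpec (φ Φinv : ℝ → ℝ) : Prop where
  pos : ∀ t : ℝ, 0 < t → 0 < Φinv t
  right_inv : ∀ t : ℝ, 0 < t → Phi φ (Φinv t) = t
  left_inv : ∀ r : ℝ, 0 < r → Φinv (Phi φ r) = r

structure HKAssumptions (d : ℕ) (φ J : ℝ → ℝ) (a₁ α₁ C₀ a b β : ℝ)
    (κ : EuclideanSpace ℝ (Fin d) → EuclideanSpace ℝ (Fin d) → ℝ)
    (κ₀ κ₁ κ₂ δ : ℝ) : Prop where
  hd : 1 ≤ d
  φ_cont : ContinuousOn φ (Set.Icc 0 1)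
  φ_mono : StrictMonoOn φ (Set.Icc 0 1)
  φ_zero : φ 0 = 0
  a₁_pos : 0 < a₁
  α₁_pos : 0 < α₁
  α₁_le : α₁ ≤ 2
  hLS : ∀ r R : ℝ, 0 < r → r ≤ R → R ≤ 1 → a₁ * (R / r) ^ α₁ ≤ φ R / φ r
  hI : MeasureTheory.IntegrableOn (fun s => s / φ s) (Set.Ioo (0:ℝ) 1)
  hC₀ : C₀ = ∫ s in Set.Ioo (0:ℝ) 1, s / φ s
  J_pos : ∀ r : ℝ, 0 < r → 0 < J r
  J_cont : ContinuousOn J (Set.Ioi 0)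
  J_anti : AntitoneOn J (Set.Ioi 0)
  J_diff : ∀ r : ℝ, 0 < r → DifferentiableAt ℝ J r
  ha : 1 ≤ a
  hb : 0 < b
  β_pos : 0 < β
  β_le : β ≤ 1
  hJ1_low : ∀ r : ℝ, 0 < r → r ≤ 1 → a⁻¹ / (r ^ d * φ r) ≤ J r
  hJ1_up : ∀ r : ℝ, 0 < r → r ≤ 1 → J r ≤ a / (r ^ d * φ r)
  hJ1_exp : ∀ r : ℝ, 1 < r → J r ≤ a * Real.exp (-b * r ^ β)
  hJ2 : AntitoneOn (fun r => -(deriv J r) / r) (Set.Ioi 0)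
  κ_meas : Measurable (Function.uncurry κ)
  κ₀_pos : 0 < κ₀
  κ₁_pos : 0 < κ₁
  κ₂_pos : 0 < κ₂
  δ_pos : 0 < δ
  δ_lt : δ < 1
  κ_low : ∀ x z, κ₀ ≤ κ x z
  κ_up : ∀ x z, κ x z ≤ κ₁
  κ_sym : ∀ x z, κ x z = κ x (-z)
  κ_holder : ∀ x y z, |κ x z - κ y z| ≤ κ₂ * ‖x - y‖ ^ δ

structure GoodHeatKernel (d : ℕ) (φ J : ℝ → ℝ) (b β : ℝ) (Φinv : ℝ → ℝ)
    (κ : EuclideanSpace ℝ (Fin d) → EuclideanSpace ℝ (Fin d) → ℝ)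
    (p : ℝ → EuclideanSpace ℝ (Fin d) → EuclideanSpace ℝ (Fin d) → ℝ) : Prop where
  cont : ContinuousOn
      (fun q : ℝ × EuclideanSpace ℝ (Fin d) × EuclideanSpace ℝ (Fin d) => p q.1 q.2.1 q.2.2)
      (Set.Ioi (0:ℝ) ×ˢ (Set.univ : Set (EuclideanSpace ℝ (Fin d) × EuclideanSpace ℝ (Fin d))))
  eqn : ∀ t : ℝ, 0 < t → ∀ x y : EuclideanSpace ℝ (Fin d), x ≠ y →
      ∃ L : ℝ, Filter.Tendsto (fun ε => Leps d κ J ε (fun x' => p t x' y) x)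
          (nhdsWithin 0 (Set.Ioi 0)) (nhds L)
        ∧ HasDerivAt (fun s => p s x y) L t
  upper : ∀ T : ℝ, 1 ≤ T → ∃ c : ℝ, 0 < c ∧ ∀ t : ℝ, 0 < t → t ≤ T →
      ∀ x y, p t x y ≤ c * t * Gfun d φ b β Φinv t (x - y)
  frac : ∀ T : ℝ, 1 ≤ T → ∃ c' : ℝ, 0 < c' ∧ ∀ ε : ℝ, 0 < ε → ε ≤ 1 →
      ∀ t : ℝ, 0 < t → t ≤ T → ∀ x y, x ≠ y →
      |Leps d κ J ε (fun x' => p t x' y) x| ≤ c' * Gtil d φ Φinv t (x - y)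
  approx : ∀ f : EuclideanSpace ℝ (Fin d) → ℝ, (∃ M, ∀ x, |f x| ≤ M) →
      UniformContinuous f → ∀ η : ℝ, 0 < η → ∃ t₀ : ℝ, 0 < t₀ ∧
      ∀ t : ℝ, 0 < t → t < t₀ → ∀ x, |(∫ y, p t x y * f y) - f x| ≤ η

open scoped Topology

section Scale

variable {d : ℕ} {φ J : ℝ → ℝ} {a₁ α₁ C₀ a b β : ℝ}
  {κ : EuclideanSpace ℝ (Fin d) → EuclideanSpace ℝ (Fin d) → ℝ} {κ₀ κ₁ κ₂ δ : ℝ}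

namespace HKAssumptions

theorem phi_pos (H : HKAssumptions d φ J a₁ α₁ C₀ a b β κ κ₀ κ₁ κ₂ δ) {s : ℝ} (hs : 0 < s)
    (hs1 : s ≤ 1) : 0 < φ s := by
  have := H.φ_mono (by simp) ⟨hs.le, hs1⟩ hs
  rwa [H.φ_zero] at this

theorem sq_div_le_integral (H : HKAssumptions d φ J a₁ α₁ C₀ a b β κ κ₀ κ₁ κ₂ δ) {r : ℝ}
    (hr : 0 < r) (hr1 : r ≤ 1) : r ^ 2 / (2 * φ r) ≤ ∫ s in Ioo (0 : ℝ) r, s / φ s := by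
  have hlin : ∫ s in Ioo (0 : ℝ) r, s / φ r = r ^ 2 / (2 * φ r) := by
    rw [← integral_Ioc_eq_integral_Ioo, ← intervalIntegral.integral_of_le hr.le,
      intervalIntegral.integral_div, integral_id]
    have := (H.phi_pos hr hr1).ne'
    field_simp
    ring
  rw [← hlin]
  refine setIntegral_mono_on ?_ (H.hI.mono_set (Ioo_subset_Ioo_right hr1)) measurableSet_Ioo ?_
  · exact ((continuous_id.div_const _).integrableOn_Icc).mono_set Ioo_subset_Icc_self
  · intro s hs
    have hs1 : s ≤ 1 := hs.2.le.trans hr1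
    exact div_le_div_of_nonneg_left hs.1.le (H.phi_pos hs.1 hs1)
      (H.φ_mono ⟨hs.1.le, hs1⟩ ⟨hr.le, hr1⟩ hs.2).le

theorem integral_le (H : HKAssumptions d φ J a₁ α₁ C₀ a b β κ κ₀ κ₁ κ₂ δ) {r : ℝ}
    (hr1 : r ≤ 1) : ∫ s in Ioo (0 : ℝ) r, s / φ s ≤ C₀ := by
  rw [H.hC₀]
  refine setIntegral_mono_set H.hI ?_ (Ioo_subset_Ioo_right hr1).eventuallyLE
  filter_upwards [ae_restrict_mem measurableSet_Ioo] with s hs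
  exact div_nonneg hs.1.le (H.phi_pos hs.1 hs.2.le).le

theorem integral_pos (H : HKAssumptions d φ J a₁ α₁ C₀ a b β κ κ₀ κ₁ κ₂ δ) {r : ℝ}
    (hr : 0 < r) (hr1 : r ≤ 1) : 0 < ∫ s in Ioo (0 : ℝ) r, s / φ s :=
  lt_of_lt_of_le (by have := H.phi_pos hr hr1; positivity) (H.sq_div_le_integral hr hr1)

theorem C₀_pos (H : HKAssumptions d φ J a₁ α₁ C₀ a b β κ κ₀ κ₁ κ₂ δ) : 0 < C₀ :=
  (H.integral_pos one_pos le_rfl).trans_le (H.integral_le le_rfl)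

theorem Phi_le (H : HKAssumptions d φ J a₁ α₁ C₀ a b β κ κ₀ κ₁ κ₂ δ) {r : ℝ}
    (hr : 0 < r) (hr1 : r ≤ 1) : Phi φ r ≤ φ r := by
  have hI := H.integral_pos hr hr1
  have h := H.sq_div_le_integral hr hr1
  have hφ := H.phi_pos hr hr1
  rw [Phi, if_pos hr1, div_le_iff₀ (by positivity)]
  rw [div_le_iff₀ (by positivity)] at h
  linarith

theorem le_Phi (H : HKAssumptions d φ J a₁ α₁ C₀ a b β κ κ₀ κ₁ κ₂ δ) {r : ℝ}
    (hr : 0 < r) : r ^ 2 / (2 * C₀) ≤ Phi φ r := by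
  rw [Phi]
  split_ifs with hr1
  · have hI := H.integral_pos hr hr1
    have := H.integral_le hr1
    gcongr
  · rw [← H.hC₀]
    exact le_of_eq (by ring)

theorem exists_le_Phi_inv (H : HKAssumptions d φ J a₁ α₁ C₀ a b β κ κ₀ κ₁ κ₂ δ) {Φinv : ℝ → ℝ}
    (HΦ : PhiInvSpec φ Φinv) {τ : ℝ} (hτ : 0 < τ) :
    ∃ ρ : ℝ, 0 < ρ ∧ ∀ t : ℝ, τ ≤ t → ρ ≤ Φinv t := by
  have h0 := H.φ_cont 0 (by simp)
  rw [Metric.continuousWithinAt_iff] at h0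
  obtain ⟨ρ, hρ, hρφ⟩ := h0 τ hτ
  refine ⟨min ρ 1, by positivity, fun t ht => ?_⟩
  by_contra! hlt
  have hpos := HΦ.pos t (hτ.trans_le ht)
  have h1 : Φinv t ≤ 1 := (hlt.trans_le (min_le_right _ _)).le
  have h2 := hρφ (x := Φinv t) ⟨hpos.le, h1⟩ (by
    rw [Real.dist_eq, sub_zero, abs_of_pos hpos]; exact hlt.trans_le (min_le_left _ _))
  rw [H.φ_zero, Real.dist_eq, sub_zero] at h2
  have h3 := H.Phi_le hpos h1
  rw [HΦ.right_inv t (hτ.trans_le ht)] at h3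
  linarith [le_abs_self (φ (Φinv t))]

theorem Gtil_le_div_norm_pow (H : HKAssumptions d φ J a₁ α₁ C₀ a b β κ κ₀ κ₁ κ₂ δ)
    (Φinv : ℝ → ℝ) (t : ℝ) {x : EuclideanSpace ℝ (Fin d)} (hx : x ≠ 0) :
    Gtil d φ Φinv t x ≤ 2 * C₀ / ‖x‖ ^ (d + 2) := by
  rw [Gtil, if_neg hx]
  refine (min_le_right _ _).trans ?_
  have hn : 0 < ‖x‖ := norm_pos_iff.2 hx
  have hC := H.C₀_pos
  calc 1 / (‖x‖ ^ d * Phi φ ‖x‖) ≤ 1 / (‖x‖ ^ d * (‖x‖ ^ 2 / (2 * C₀))) := by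
        have := H.le_Phi hn
        gcongr
    _ = 2 * C₀ / ‖x‖ ^ (d + 2) := by field_simp; ring

theorem exists_Gtil_le (H : HKAssumptions d φ J a₁ α₁ C₀ a b β κ κ₀ κ₁ κ₂ δ) {Φinv : ℝ → ℝ}
    (HΦ : PhiInvSpec φ Φinv) {τ : ℝ} (hτ : 0 < τ) :
    ∃ M : ℝ, 0 < M ∧ ∀ t : ℝ, τ ≤ t → ∀ x : EuclideanSpace ℝ (Fin d), Gtil d φ Φinv t x ≤ M := by
  obtain ⟨ρ, hρ, h⟩ := H.exists_le_Phi_inv HΦ hτ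
  refine ⟨1 / (τ * ρ ^ d), by positivity, fun t ht x => ?_⟩
  have hmain : 1 / (t * Φinv t ^ d) ≤ 1 / (τ * ρ ^ d) := by
    have := h t ht
    have ht0 : 0 < t := hτ.trans_le ht
    gcongr
  rw [Gtil]
  split_ifs
  · exact hmain
  · exact (min_le_left _ _).trans hmain

theorem integrableOn_jump (H : HKAssumptions d φ J a₁ α₁ C₀ a b β κ κ₀ κ₁ κ₂ δ) {ε : ℝ}
    (hε : 0 < ε) :
    IntegrableOn (fun z : EuclideanSpace ℝ (Fin d) => J ‖z‖) {z | ε < ‖z‖} := by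
  have hd := H.hd
  have : Nonempty (Fin d) := ⟨⟨0, hd⟩⟩
  have hmeas : MeasurableSet {z : EuclideanSpace ℝ (Fin d) | ε < ‖z‖} :=
    measurableSet_lt measurable_const measurable_norm
  have hexp : Integrable (fun z : EuclideanSpace ℝ (Fin d) => Real.exp (-b * ‖z‖ ^ β)) := by
    rw [integrable_fun_norm_addHaar volume (f := fun r => Real.exp (-b * r ^ β))]
    refine (integrableOn_rpow_mul_exp_neg_mul_rpow (s := ((d - 1 : ℕ) : ℝ)) (p := β) (b := b)
      (by linarith [Nat.cast_nonneg (α := ℝ) (d - 1)]) H.β_pos H.hb).congr_fun ?_ measurableSet_Ioi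
    intro r _
    simp [Real.rpow_natCast]
  have hball : Integrable ((Metric.closedBall (0 : EuclideanSpace ℝ (Fin d)) 1).indicator
      fun _ => J ε) :=
    (integrable_indicator_iff Metric.isClosed_closedBall.measurableSet).2
      (integrableOn_const (isCompact_closedBall _ _).measure_ne_top)
  refine ((hball.add (hexp.const_mul a)).integrableOn).mono' ?_ ?_
  · refine ContinuousOn.aestronglyMeasurable ?_ hmeas
    exact H.J_cont.comp continuous_norm.continuousOn fun z hz => hε.trans hz
  · filter_upwards [ae_restrict_mem hmeas] with z hz
    have hz0 : 0 < ‖z‖ := hε.trans hz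
    rw [Real.norm_of_nonneg (H.J_pos _ hz0).le, Pi.add_apply]
    have ha : 0 < a := one_pos.trans_le H.ha
    rcases le_or_gt ‖z‖ 1 with h1 | h1
    · rw [indicator_of_mem (by simpa using h1)]
      have := H.J_anti hε hz0 (le_of_lt hz)
      have := Real.exp_pos (-b * ‖z‖ ^ β)
      nlinarith
    · rw [indicator_of_notMem (by simpa using h1), zero_add]
      exact H.hJ1_exp _ h1

end HKAssumptions

end Scale

/-- The action `∫ p(t,x,y) f(y) dy` of a kernel on a function. -/
noncomputable def kernelIntegral {d : ℕ}
    (p : ℝ → EuclideanSpace ℝ (Fin d) → EuclideanSpace ℝ (Fin d) → ℝ)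
    (f : EuclideanSpace ℝ (Fin d) → ℝ) (t : ℝ) (x : EuclideanSpace ℝ (Fin d)) : ℝ :=
  ∫ y, p t x y * f y

section Kernel

variable {d : ℕ} {φ J : ℝ → ℝ} {a₁ α₁ C₀ a b β : ℝ}
  {κ : EuclideanSpace ℝ (Fin d) → EuclideanSpace ℝ (Fin d) → ℝ} {κ₀ κ₁ κ₂ δ : ℝ}
  {Φinv : ℝ → ℝ} {p q : ℝ → EuclideanSpace ℝ (Fin d) → EuclideanSpace ℝ (Fin d) → ℝ}
  {f : EuclideanSpace ℝ (Fin d) → ℝ}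

namespace GoodHeatKernel

theorem continuous_prod (hp : GoodHeatKernel d φ J b β Φinv κ p) {t : ℝ} (ht : 0 < t) :
    Continuous fun u : EuclideanSpace ℝ (Fin d) × EuclideanSpace ℝ (Fin d) => p t u.1 u.2 :=
  hp.cont.comp_continuous (f := fun u => (t, u)) (by fun_prop) fun _ => ⟨ht, mem_univ _⟩

theorem continuous_snd (hp : GoodHeatKernel d φ J b β Φinv κ p) {t : ℝ} (ht : 0 < t)
    (x : EuclideanSpace ℝ (Fin d)) : Continuous fun y => p t x y :=
  (hp.continuous_prod ht).comp (Continuous.prodMk_right x)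

theorem integrable_mul (hp : GoodHeatKernel d φ J b β Φinv κ p) (hf : Continuous f)
    (hfc : HasCompactSupport f) {t : ℝ} (ht : 0 < t) (x : EuclideanSpace ℝ (Fin d)) :
    Integrable fun y => p t x y * f y :=
  ((hp.continuous_snd ht x).mul hf).integrable_of_hasCompactSupport hfc.mul_left

theorem exists_Leps_le_div (hp : GoodHeatKernel d φ J b β Φinv κ p)
    (H : HKAssumptions d φ J a₁ α₁ C₀ a b β κ κ₀ κ₁ κ₂ δ) {T : ℝ} (hT : 1 ≤ T) :
    ∃ c : ℝ, 0 < c ∧ ∀ ε : ℝ, 0 < ε → ε ≤ 1 → ∀ t : ℝ, 0 < t → t ≤ T → ∀ x y, x ≠ y →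
      |Leps d κ J ε (fun x' => p t x' y) x| ≤ c / ‖x - y‖ ^ (d + 2) := by
  obtain ⟨c, hc, h⟩ := hp.frac T hT
  have hC := H.C₀_pos
  refine ⟨c * (2 * C₀), by positivity, fun ε hε hε1 t ht htT x y hxy => ?_⟩
  refine (h ε hε hε1 t ht htT x y hxy).trans ?_
  rw [mul_div_assoc]
  exact mul_le_mul_of_nonneg_left (H.Gtil_le_div_norm_pow Φinv t (sub_ne_zero.2 hxy)) hc.le

theorem exists_Leps_le_const (hp : GoodHeatKernel d φ J b β Φinv κ p)
    (H : HKAssumptions d φ J a₁ α₁ C₀ a b β κ κ₀ κ₁ κ₂ δ) (HΦ : PhiInvSpec φ Φinv)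
    {τ T : ℝ} (hτ : 0 < τ) (hT : 1 ≤ T) :
    ∃ M : ℝ, 0 < M ∧ ∀ ε : ℝ, 0 < ε → ε ≤ 1 → ∀ t : ℝ, τ ≤ t → t ≤ T → ∀ x y, x ≠ y →
      |Leps d κ J ε (fun x' => p t x' y) x| ≤ M := by
  obtain ⟨c, hc, h⟩ := hp.frac T hT
  obtain ⟨M, hM, hG⟩ := H.exists_Gtil_le (d := d) HΦ hτ
  refine ⟨c * M, by positivity, fun ε hε hε1 t ht htT x y hxy => ?_⟩
  exact (h ε hε hε1 t (hτ.trans_le ht) htT x y hxy).trans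
    (mul_le_mul_of_nonneg_left (hG t ht _) hc.le)

/-- A bound on the truncated operators passes to the time derivative. -/
theorem abs_deriv_le (hp : GoodHeatKernel d φ J b β Φinv κ p) {t B : ℝ} (ht : 0 < t)
    {x y : EuclideanSpace ℝ (Fin d)} (hxy : x ≠ y)
    (hB : ∀ ε : ℝ, 0 < ε → ε ≤ 1 → |Leps d κ J ε (fun x' => p t x' y) x| ≤ B) :
    |deriv (fun s => p s x y) t| ≤ B := by
  obtain ⟨L, hL, hder⟩ := hp.eqn t ht x y hxy
  rw [hder.deriv]
  refine le_of_tendsto hL.abs ?_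
  filter_upwards [Ioc_mem_nhdsGT (zero_lt_one' ℝ)] with ε hε using hB ε hε.1 hε.2

theorem hasDerivAt (hp : GoodHeatKernel d φ J b β Φinv κ p) {t : ℝ} (ht : 0 < t)
    {x y : EuclideanSpace ℝ (Fin d)} (hxy : x ≠ y) :
    HasDerivAt (fun s => p s x y) (deriv (fun s => p s x y) t) t := by
  obtain ⟨L, -, hder⟩ := hp.eqn t ht x y hxy
  exact hder.differentiableAt.hasDerivAt

theorem tendsto_Leps (hp : GoodHeatKernel d φ J b β Φinv κ p) {t : ℝ} (ht : 0 < t)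
    {x y : EuclideanSpace ℝ (Fin d)} (hxy : x ≠ y) :
    Tendsto (fun ε => Leps d κ J ε (fun x' => p t x' y) x) (𝓝[>] 0)
      (𝓝 (deriv (fun s => p s x y) t)) := by
  obtain ⟨L, hL, hder⟩ := hp.eqn t ht x y hxy
  rwa [hder.deriv]

/-- Off the diagonal a good heat kernel decays polynomially from both sides. -/
theorem exists_abs_le (hp : GoodHeatKernel d φ J b β Φinv κ p)
    (H : HKAssumptions d φ J a₁ α₁ C₀ a b β κ κ₀ κ₁ κ₂ δ) {T : ℝ} (hT : 1 ≤ T) :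
    ∃ c : ℝ, 0 < c ∧ ∀ t : ℝ, 0 < t → t ≤ T → ∀ x y, x ≠ y →
      |p t x y| ≤ c / ‖x - y‖ ^ (d + 2) := by
  obtain ⟨c, hc, h⟩ := hp.exists_Leps_le_div H hT
  have hT0 : 0 < T := one_pos.trans_le hT
  refine ⟨c * T * 2 ^ (d + 2), by positivity, fun t ht htT x y hxy => ?_⟩
  have hn : 0 < ‖x - y‖ := norm_pos_iff.2 (sub_ne_zero.2 hxy)
  refine le_of_forall_pos_le_add fun η hη => ?_
  have hcy := (hp.continuous_snd ht x).continuousAt (x := y)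
  obtain ⟨ρ, hρ, hρp⟩ := Metric.continuousAt_iff.1 hcy (η / 2) (by positivity)
  set R := min ρ (‖x - y‖ / 2) with hR
  have hR0 : 0 < R := by positivity
  let g : ContDiffBump y := ⟨R / 2, R, by positivity, by linarith⟩
  have hgball : ∀ z, g.normed volume z ≠ 0 → dist z y < R := fun z hz => by
    have : z ∈ Function.support (g.normed volume) := hz
    rwa [g.support_normed_eq] at this
  have hgc : Continuous (g.normed volume) := g.continuous_normed
  have hgcs : HasCompactSupport (g.normed volume) := g.hasCompactSupport_normed
  have hgint : Integrable (g.normed volume) := hgc.integrable_of_hasCompactSupport hgcs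
  obtain ⟨Mg, hMg⟩ := hgc.bounded_above_of_compact_support hgcs
  obtain ⟨t₀, ht₀, happ⟩ := hp.approx (g.normed volume) ⟨Mg, hMg⟩
    (hgc.uniformContinuous_of_tendsto_cocompact (hgcs.is_zero_at_infty)) (η / 2) (by positivity)
  set s := min (t / 2) (t₀ / 2) with hs
  have hs0 : 0 < s := by positivity
  have hst : s ≤ t := (min_le_left _ _).trans (by linarith)
  have hst₀ : s < t₀ := (min_le_right _ _).trans_lt (by linarith)
  have hgx : g.normed volume x = 0 := by
    by_contra hne
    have h1 := hgball x hne
    have h2 : R ≤ ‖x - y‖ / 2 := min_le_right _ _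
    rw [dist_eq_norm] at h1
    linarith
  have hsmall := happ s hs0 hst₀ x
  rw [hgx, sub_zero] at hsmall
  have hpt : ∀ z, |(p t x y - p s x z) * g.normed volume z|
      ≤ (η / 2 + c * T * 2 ^ (d + 2) / ‖x - y‖ ^ (d + 2)) * g.normed volume z := fun z => by
    rw [abs_mul, abs_of_nonneg (g.nonneg_normed z)]
    rcases eq_or_ne (g.normed volume z) 0 with h0 | h0
    · simp [h0]
    refine mul_le_mul_of_nonneg_right ?_ (g.nonneg_normed z)
    have hz := hgball z h0
    have hz1 : |p t x z - p t x y| < η / 2 := hρp (hz.trans_le (min_le_left _ _))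
    have hz2 : ‖x - y‖ / 2 ≤ ‖x - z‖ := by
      have h1 : dist z y < ‖x - y‖ / 2 := hz.trans_le (min_le_right _ _)
      rw [dist_eq_norm] at h1
      have h2 : ‖x - y‖ ≤ ‖x - z‖ + ‖z - y‖ := norm_sub_le_norm_sub_add_norm_sub x z y
      linarith
    have hxz : x ≠ z := by
      rintro rfl
      rw [sub_self, norm_zero] at hz2
      linarith
    have hlip := (convex_Icc s t).norm_image_sub_le_of_norm_hasDerivWithin_le
      (f := fun u => p u x z) (f' := fun u => deriv (fun u => p u x z) u)
      (C := c * 2 ^ (d + 2) / ‖x - y‖ ^ (d + 2))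
      (fun u hu => (hp.hasDerivAt (hs0.trans_le hu.1) hxz).hasDerivWithinAt)
      (fun u hu => by
        refine (hp.abs_deriv_le (hs0.trans_le hu.1) hxz fun ε hε hε1 =>
          h ε hε hε1 u (hs0.trans_le hu.1) (hu.2.trans htT) x z hxz).trans ?_
        calc c / ‖x - z‖ ^ (d + 2) ≤ c / (‖x - y‖ / 2) ^ (d + 2) := by gcongr
          _ = c * 2 ^ (d + 2) / ‖x - y‖ ^ (d + 2) := by rw [div_pow, div_div_eq_mul_div])
      (left_mem_Icc.2 hst) (right_mem_Icc.2 hst)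
    have hlip2 : |p t x z - p s x z| ≤ c * T * 2 ^ (d + 2) / ‖x - y‖ ^ (d + 2) := by
      refine hlip.trans ?_
      rw [Real.norm_of_nonneg (sub_nonneg.2 hst)]
      calc c * 2 ^ (d + 2) / ‖x - y‖ ^ (d + 2) * (t - s)
          ≤ c * 2 ^ (d + 2) / ‖x - y‖ ^ (d + 2) * T := by gcongr; linarith
        _ = c * T * 2 ^ (d + 2) / ‖x - y‖ ^ (d + 2) := by ring
    calc |p t x y - p s x z| ≤ |p t x y - p t x z| + |p t x z - p s x z| := abs_sub_le _ _ _
      _ ≤ η / 2 + c * T * 2 ^ (d + 2) / ‖x - y‖ ^ (d + 2) := by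
        rw [abs_sub_comm (p t x y)]
        exact add_le_add hz1.le hlip2
  have hsint := hp.integrable_mul hgc hgcs hs0 x
  have heq : p t x y = (∫ z, (p t x y - p s x z) * g.normed volume z)
      + ∫ z, p s x z * g.normed volume z := by
    simp_rw [sub_mul]
    rw [integral_sub (hgint.const_mul _) hsint, integral_const_mul, g.integral_normed]
    ring
  have hbig : |∫ z, (p t x y - p s x z) * g.normed volume z|
      ≤ η / 2 + c * T * 2 ^ (d + 2) / ‖x - y‖ ^ (d + 2) := by
    rw [← Real.norm_eq_abs]
    refine (norm_integral_le_of_norm_le (hgint.const_mul _) (.of_forall hpt)).trans ?_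
    rw [integral_const_mul, g.integral_normed, mul_one]
  rw [heq]
  refine (abs_add_le _ _).trans ?_
  linarith

/-- At a fixed time a good heat kernel is bounded when its second variable stays in a compact
set. -/
theorem exists_abs_le_of_isCompact (hp : GoodHeatKernel d φ J b β Φinv κ p)
    (H : HKAssumptions d φ J a₁ α₁ C₀ a b β κ κ₀ κ₁ κ₂ δ)
    {K : Set (EuclideanSpace ℝ (Fin d))} (hK : IsCompact K) {t : ℝ} (ht : 0 < t) :
    ∃ M : ℝ, 0 < M ∧ ∀ x, ∀ y ∈ K, |p t x y| ≤ M := by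
  obtain ⟨c, hc, h⟩ := hp.exists_abs_le H (le_max_right t 1)
  obtain ⟨M, hM⟩ := (hK.cthickening (r := 1)).prod hK |>.exists_bound_of_continuousOn
    (hp.continuous_prod ht).continuousOn
  refine ⟨max M c, lt_max_of_lt_right hc, fun x y hy => ?_⟩
  rcases le_or_gt (dist x y) 1 with h1 | h1
  · exact (hM (x, y) ⟨Metric.mem_cthickening_of_dist_le x y 1 K hy h1, hy⟩).trans (le_max_left _ _)
  · have hxy : x ≠ y := fun he => by simp [he] at h1; linarith
    refine ((h t ht (le_max_left _ _) x y hxy).trans ?_).trans (le_max_right _ _)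
    rw [dist_eq_norm] at h1
    exact div_le_self hc.le (one_le_pow₀ h1.le)

theorem continuousOn_kernelIntegral (hp : GoodHeatKernel d φ J b β Φinv κ p) (hf : Continuous f)
    (hfc : HasCompactSupport f) :
    ContinuousOn (fun u : ℝ × EuclideanSpace ℝ (Fin d) => kernelIntegral p f u.1 u.2)
      (Ioi 0 ×ˢ univ) := by
  refine continuousOn_integral_of_compact_support (s := Ioi 0 ×ˢ univ)
    (f := fun (u : ℝ × EuclideanSpace ℝ (Fin d)) y => p u.1 u.2 y * f y) hfc ?_ ?_
  · refine ContinuousOn.mul ?_ (by fun_prop)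
    exact hp.cont.comp (f := fun v : (ℝ × EuclideanSpace ℝ (Fin d)) × EuclideanSpace ℝ (Fin d) =>
      (v.1.1, v.1.2, v.2)) (by fun_prop) fun v hv => ⟨hv.1.1, mem_univ _⟩
  · intro u y _ hy
    rw [image_eq_zero_of_notMem_tsupport hy, mul_zero]

theorem integrable_jump_prod (hp : GoodHeatKernel d φ J b β Φinv κ p)
    (H : HKAssumptions d φ J a₁ α₁ C₀ a b β κ κ₀ κ₁ κ₂ δ) (hf : Continuous f)
    (hfc : HasCompactSupport f) {t : ℝ} (ht : 0 < t) (x : EuclideanSpace ℝ (Fin d)) {ε : ℝ}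
    (hε : 0 < ε) :
    Integrable (fun u : EuclideanSpace ℝ (Fin d) × EuclideanSpace ℝ (Fin d) =>
        (p t (x + u.1) u.2 - p t x u.2) * f u.2 * (κ x u.1 * J ‖u.1‖))
      ((volume.restrict {z | ε < ‖z‖}).prod volume) := by
  obtain ⟨M, hM0, hM⟩ := hp.exists_abs_le_of_isCompact H hfc ht
  have hJ := H.integrableOn_jump hε
  have hfi : Integrable f := hf.integrable_of_hasCompactSupport hfc
  have hκ : Measurable (κ x) := H.κ_meas.comp (measurable_const.prodMk measurable_id)
  refine (Integrable.mul_prod (hJ.const_mul (2 * M * κ₁)) hfi.norm).mono' ?_ ?_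
  · refine AEStronglyMeasurable.mul ?_ (AEStronglyMeasurable.mul ?_ ?_)
    · refine (Continuous.mul (Continuous.sub ?_ ?_) (by fun_prop)).aestronglyMeasurable
      · exact (hp.continuous_prod ht).comp (f := fun u :
          EuclideanSpace ℝ (Fin d) × EuclideanSpace ℝ (Fin d) => (x + u.1, u.2)) (by fun_prop)
      · exact (hp.continuous_snd ht x).comp _root_.continuous_snd
    · exact (hκ.comp measurable_fst).aestronglyMeasurable
    · exact hJ.aestronglyMeasurable.comp_fst
  · have hmeas : MeasurableSet {z : EuclideanSpace ℝ (Fin d) | ε < ‖z‖} :=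
      measurableSet_lt measurable_const measurable_norm
    have hmem : ∀ᵐ u ∂((volume.restrict {z : EuclideanSpace ℝ (Fin d) | ε < ‖z‖}).prod
        (volume : Measure (EuclideanSpace ℝ (Fin d)))), ε < ‖u.1‖ :=
      Measure.quasiMeasurePreserving_fst.ae (ae_restrict_mem hmeas)
    filter_upwards [hmem] with u hu
    have hJ0 := (H.J_pos _ (hε.trans hu)).le
    have hκ0 : 0 ≤ κ x u.1 := H.κ₀_pos.le.trans (H.κ_low _ _)
    have hκ1 := H.κ_up x u.1
    rcases eq_or_ne (f u.2) 0 with h0 | h0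
    · simp [h0]
    have hy : u.2 ∈ tsupport f := subset_tsupport f h0
    have hb : ‖p t (x + u.1) u.2 - p t x u.2‖ ≤ 2 * M :=
      (norm_sub_le _ _).trans (by
        have h1 := hM (x + u.1) _ hy
        have h2 := hM x _ hy
        simp only [Real.norm_eq_abs]
        linarith)
    rw [norm_mul, norm_mul, norm_mul, Real.norm_of_nonneg hJ0, Real.norm_of_nonneg hκ0]
    calc ‖p t (x + u.1) u.2 - p t x u.2‖ * ‖f u.2‖ * (κ x u.1 * J ‖u.1‖)
        ≤ 2 * M * ‖f u.2‖ * (κ₁ * J ‖u.1‖) := by gcongr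
      _ = 2 * M * κ₁ * J ‖u.1‖ * ‖f u.2‖ := by ring

theorem kernelIntegral_jump_eq (hp : GoodHeatKernel d φ J b β Φinv κ p) (hf : Continuous f)
    (hfc : HasCompactSupport f) {t : ℝ} (ht : 0 < t) (x z : EuclideanSpace ℝ (Fin d)) :
    ∫ y, (p t (x + z) y - p t x y) * f y * (κ x z * J ‖z‖) =
      (kernelIntegral p f t (x + z) - kernelIntegral p f t x) * (κ x z * J ‖z‖) := by
  rw [integral_mul_const]
  simp_rw [sub_mul]
  rw [integral_sub (hp.integrable_mul hf hfc ht _) (hp.integrable_mul hf hfc ht _)]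
  simp [kernelIntegral, sub_mul]

theorem integrableOn_jump_kernelIntegral (hp : GoodHeatKernel d φ J b β Φinv κ p)
    (H : HKAssumptions d φ J a₁ α₁ C₀ a b β κ κ₀ κ₁ κ₂ δ) (hf : Continuous f)
    (hfc : HasCompactSupport f) {t : ℝ} (ht : 0 < t) (x : EuclideanSpace ℝ (Fin d)) {ε : ℝ}
    (hε : 0 < ε) :
    IntegrableOn (fun z => (kernelIntegral p f t (x + z) - kernelIntegral p f t x)
      * (κ x z * J ‖z‖)) {z | ε < ‖z‖} := by
  have h := (hp.integrable_jump_prod H hf hfc ht x hε).integral_prod_left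
  simpa only [IntegrableOn, hp.kernelIntegral_jump_eq hf hfc ht] using h

theorem Leps_kernelIntegral (hp : GoodHeatKernel d φ J b β Φinv κ p)
    (H : HKAssumptions d φ J a₁ α₁ C₀ a b β κ κ₀ κ₁ κ₂ δ) (hf : Continuous f)
    (hfc : HasCompactSupport f) {t : ℝ} (ht : 0 < t) (x : EuclideanSpace ℝ (Fin d)) {ε : ℝ}
    (hε : 0 < ε) :
    Integrable (fun y => Leps d κ J ε (fun x' => p t x' y) x * f y) ∧
      Leps d κ J ε (kernelIntegral p f t) x
        = ∫ y, Leps d κ J ε (fun x' => p t x' y) x * f y := by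
  have h := hp.integrable_jump_prod H hf hfc ht x hε
  have hin : ∀ y, ∫ z in {z | ε < ‖z‖}, (p t (x + z) y - p t x y) * f y * (κ x z * J ‖z‖)
      = Leps d κ J ε (fun x' => p t x' y) x * f y := fun y => by
    rw [Leps, ← integral_mul_const]
    exact integral_congr_ae (.of_forall fun z => by ring)
  constructor
  · simpa only [hin] using h.integral_prod_right
  · have hswap := integral_integral_swap (f := fun z y =>
      (p t (x + z) y - p t x y) * f y * (κ x z * J ‖z‖)) h
    simp only [hin, hp.kernelIntegral_jump_eq hf hfc ht] at hswap
    exact hswap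

/-- The kernel integral of a test function solves the heat equation at every point. -/
theorem exists_kernelIntegral_eqn (hp : GoodHeatKernel d φ J b β Φinv κ p)
    (H : HKAssumptions d φ J a₁ α₁ C₀ a b β κ κ₀ κ₁ κ₂ δ) (HΦ : PhiInvSpec φ Φinv)
    (hf : Continuous f) (hfc : HasCompactSupport f) {t : ℝ} (ht : 0 < t)
    (x : EuclideanSpace ℝ (Fin d)) :
    ∃ L : ℝ, Tendsto (fun ε => Leps d κ J ε (kernelIntegral p f t) x) (𝓝[>] 0) (𝓝 L) ∧
      HasDerivAt (fun s => kernelIntegral p f s x) L t := by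
  have : Nonempty (Fin d) := ⟨⟨0, H.hd⟩⟩
  obtain ⟨M, hM0, hM⟩ := hp.exists_Leps_le_const H HΦ (half_pos ht) (le_max_right (2 * t) 1)
  have hfi : Integrable f := hf.integrable_of_hasCompactSupport hfc
  have hae : ∀ᵐ y : EuclideanSpace ℝ (Fin d), x ≠ y := by
    filter_upwards [Measure.ae_ne volume x] with y hy using hy.symm
  have hlim : ∀ᵐ y : EuclideanSpace ℝ (Fin d),
      Tendsto (fun ε => Leps d κ J ε (fun x' => p t x' y) x * f y) (𝓝[>] 0)
        (𝓝 (deriv (fun s => p s x y) t * f y)) := by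
    filter_upwards [hae] with y hy using (hp.tendsto_Leps ht hy).mul_const _
  have hmeas : ∀ᶠ ε in 𝓝[>] (0 : ℝ),
      AEStronglyMeasurable (fun y => Leps d κ J ε (fun x' => p t x' y) x * f y) volume := by
    filter_upwards [self_mem_nhdsWithin] with ε hε
    exact (hp.Leps_kernelIntegral H hf hfc ht x hε).1.aestronglyMeasurable
  have htm : t / 2 ≤ t ∧ t ≤ max (2 * t) 1 := ⟨by linarith, le_max_of_le_left (by linarith)⟩
  refine ⟨∫ y, deriv (fun s => p s x y) t * f y, ?_, ?_⟩
  · have hdct := tendsto_integral_filter_of_dominated_convergence (fun y => M * ‖f y‖)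
      hmeas (by
        filter_upwards [Ioc_mem_nhdsGT (zero_lt_one' ℝ)] with ε hε
        filter_upwards [hae] with y hy
        rw [norm_mul]
        exact mul_le_mul_of_nonneg_right (hM ε hε.1 hε.2 t htm.1 htm.2 x y hy) (norm_nonneg _))
      (hfi.norm.const_mul M) hlim
    refine hdct.congr' ?_
    filter_upwards [self_mem_nhdsWithin] with ε hε
    exact (hp.Leps_kernelIntegral H hf hfc ht x hε).2.symm
  · have hnhds : Ioo (t / 2) (2 * t) ∈ 𝓝 t := Ioo_mem_nhds (by linarith) (by linarith)
    refine (hasDerivAt_integral_of_dominated_loc_of_deriv_le (F := fun s y => p s x y * f y)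
      (F' := fun s y => deriv (fun s => p s x y) s * f y) (bound := fun y => M * ‖f y‖)
      hnhds ?_ (hp.integrable_mul hf hfc ht x) ?_ ?_ (hfi.norm.const_mul M) ?_).2
    · filter_upwards [lt_mem_nhds ht] with s hs
      exact (hp.integrable_mul hf hfc hs x).aestronglyMeasurable
    · have hseq : Tendsto (fun n : ℕ => 1 / ((n : ℝ) + 1)) atTop (𝓝[>] 0) :=
        tendsto_nhdsWithin_iff.2 ⟨tendsto_one_div_add_atTop_nhds_zero_nat,
          .of_forall fun n => mem_Ioi.2 Nat.one_div_pos_of_nat⟩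
      refine aestronglyMeasurable_of_tendsto_ae atTop (fun n : ℕ =>
        (hp.Leps_kernelIntegral H hf hfc ht x (Nat.one_div_pos_of_nat (n := n))).1.1) ?_
      filter_upwards [hlim] with y hy using hy.comp hseq
    · filter_upwards [hae] with y hy s hs
      rw [norm_mul]
      refine mul_le_mul_of_nonneg_right ?_ (norm_nonneg _)
      refine hp.abs_deriv_le (by linarith [hs.1]) hy fun ε hε hε1 => ?_
      exact hM ε hε hε1 s hs.1.le (hs.2.le.trans (le_max_left _ _)) x y hy
    · filter_upwards [hae] with y hy s hs
      exact (hp.hasDerivAt (by linarith [hs.1]) hy).mul_const _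

/-- The kernel integral of a test function vanishes at infinity, uniformly in bounded time. -/
theorem exists_kernelIntegral_le (hp : GoodHeatKernel d φ J b β Φinv κ p)
    (H : HKAssumptions d φ J a₁ α₁ C₀ a b β κ κ₀ κ₁ κ₂ δ) (hf : Continuous f)
    (hfc : HasCompactSupport f) {T η : ℝ} (hT : 1 ≤ T) (hη : 0 < η) :
    ∃ R : ℝ, ∀ t : ℝ, 0 < t → t ≤ T → ∀ x, R < ‖x‖ → |kernelIntegral p f t x| ≤ η := by
  obtain ⟨c, hc, h⟩ := hp.exists_abs_le H hT
  have hfi : Integrable f := hf.integrable_of_hasCompactSupport hfc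
  obtain ⟨R₀, hR₀⟩ := hfc.isBounded.subset_closedBall (0 : EuclideanSpace ℝ (Fin d))
  set I := ∫ y, ‖f y‖ with hI
  set ρ := max 1 (c * I / η) with hρ
  have hρ1 : 1 ≤ ρ := le_max_left _ _
  refine ⟨R₀ + ρ, fun t ht htT x hx => ?_⟩
  have hpt : ∀ y, ‖p t x y * f y‖ ≤ c / ρ * ‖f y‖ := fun y => by
    rcases eq_or_ne (f y) 0 with h0 | h0
    · simp [h0]
    have hy : ‖y‖ ≤ R₀ := by simpa using hR₀ (subset_tsupport f h0)
    have hxy : ρ ≤ ‖x - y‖ := by linarith [norm_sub_norm_le x y]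
    have hne : x ≠ y := by
      rintro rfl
      rw [sub_self, norm_zero] at hxy
      linarith
    rw [norm_mul]
    refine mul_le_mul_of_nonneg_right ((h t ht htT x y hne).trans ?_) (norm_nonneg _)
    refine div_le_div_of_nonneg_left hc.le (by linarith) (hxy.trans ?_)
    exact le_self_pow₀ (hρ1.trans hxy) (by omega)
  rw [kernelIntegral, ← Real.norm_eq_abs]
  refine (norm_integral_le_of_norm_le (hfi.norm.const_mul _) (.of_forall hpt)).trans ?_
  rw [integral_const_mul, div_mul_eq_mul_div, div_le_iff₀ (by linarith), ← div_le_iff₀' hη]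
  exact le_max_right _ _

/-- Maximum principle: two good heat kernels act in the same way on test functions, one
inequality at a time. -/
theorem kernelIntegral_le (hp : GoodHeatKernel d φ J b β Φinv κ p)
    (hq : GoodHeatKernel d φ J b β Φinv κ q)
    (H : HKAssumptions d φ J a₁ α₁ C₀ a b β κ κ₀ κ₁ κ₂ δ) (HΦ : PhiInvSpec φ Φinv)
    (hf : Continuous f) (hfc : HasCompactSupport f) {t : ℝ} (ht : 0 < t)
    (x : EuclideanSpace ℝ (Fin d)) : kernelIntegral p f t x ≤ kernelIntegral q f t x := by
  by_contra! hlt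
  set w : ℝ → EuclideanSpace ℝ (Fin d) → ℝ :=
    fun s z => kernelIntegral p f s z - kernelIntegral q f s z with hw
  set A := w t x with hA
  have hA0 : 0 < A := sub_pos.2 hlt
  obtain ⟨Mf, hMf⟩ := hf.bounded_above_of_compact_support hfc
  have hfu : UniformContinuous f :=
    hf.uniformContinuous_of_tendsto_cocompact hfc.is_zero_at_infty
  obtain ⟨t₁, ht₁, happ₁⟩ := hp.approx f ⟨Mf, hMf⟩ hfu (A / 8) (by positivity)
  obtain ⟨t₂, ht₂, happ₂⟩ := hq.approx f ⟨Mf, hMf⟩ hfu (A / 8) (by positivity)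
  obtain ⟨R₁, hR₁⟩ := hp.exists_kernelIntegral_le H hf hfc (le_max_right t 1)
    (show 0 < A / 8 by positivity)
  obtain ⟨R₂, hR₂⟩ := hq.exists_kernelIntegral_le H hf hfc (le_max_right t 1)
    (show 0 < A / 8 by positivity)
  set τ := min t₁ t₂ with hτ
  set R := max R₁ R₂ with hR
  have hτ0 : 0 < τ := lt_min ht₁ ht₂
  have hinit : ∀ s, 0 < s → s < τ → ∀ z, w s z ≤ A / 4 := fun s hs hsτ z => by
    have h1 := abs_le.1 (happ₁ s hs (hsτ.trans_le (min_le_left _ _)) z)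
    have h2 := abs_le.1 (happ₂ s hs (hsτ.trans_le (min_le_right _ _)) z)
    simp only [hw, kernelIntegral]
    linarith [h1.2, h2.1]
  have hfar : ∀ s, 0 < s → s ≤ t → ∀ z, R < ‖z‖ → w s z ≤ A / 4 := fun s hs hst z hz => by
    have h1 := abs_le.1 (hR₁ s hs (hst.trans (le_max_left _ _)) z ((le_max_left _ _).trans_lt hz))
    have h2 := abs_le.1 (hR₂ s hs (hst.trans (le_max_left _ _)) z ((le_max_right _ _).trans_lt hz))
    simp only [hw]
    linarith [h1.2, h2.1]
  set η := A / (2 * t) with hη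
  have hη0 : 0 < η := by positivity
  have hηt : η * t = A / 2 := by rw [hη]; field_simp
  have hmem : (t, x) ∈ Icc τ t ×ˢ Metric.closedBall (0 : EuclideanSpace ℝ (Fin d)) R := by
    refine ⟨⟨?_, le_rfl⟩, ?_⟩
    · by_contra! hlt'
      linarith [hinit t ht hlt' x]
    · rw [mem_closedBall_zero_iff]
      by_contra! hlt'
      linarith [hfar t ht le_rfl x hlt']
  have hcont : ContinuousOn (fun u : ℝ × EuclideanSpace ℝ (Fin d) => w u.1 u.2 - η * u.1)
      (Icc τ t ×ˢ Metric.closedBall 0 R) := by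
    refine ContinuousOn.sub (ContinuousOn.mono (ContinuousOn.sub
      (hp.continuousOn_kernelIntegral hf hfc) (hq.continuousOn_kernelIntegral hf hfc)) ?_)
      (by fun_prop)
    exact prod_mono (fun s hs => hτ0.trans_le hs.1) (subset_univ _)
  obtain ⟨⟨s, z⟩, hsz, hmax⟩ := (isCompact_Icc.prod (isCompact_closedBall _ _)).exists_isMaxOn
    ⟨_, hmem⟩ hcont
  have hs0 : 0 < s := hτ0.trans_le hsz.1.1
  have hst : s ≤ t := hsz.1.2
  have hval : A / 2 ≤ w s z - η * s := by
    have : w t x - η * t ≤ w s z - η * s := hmax hmem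
    linarith
  have hglob : ∀ s', 0 < s' → s' ≤ t → ∀ z', w s' z' - η * s' ≤ w s z - η * s := by
    intro s' hs' hs't z'
    have hpos : 0 < η * s' := by positivity
    rcases lt_or_ge s' τ with h1 | h1
    · linarith [hinit s' hs' h1 z']
    rcases lt_or_ge R ‖z'‖ with h2 | h2
    · linarith [hfar s' hs' hs't z' h2]
    exact hmax (show (s', z') ∈ Icc τ t ×ˢ Metric.closedBall 0 R from
      ⟨⟨h1, hs't⟩, mem_closedBall_zero_iff.2 h2⟩)
  obtain ⟨L₁, hL₁, hder₁⟩ := hp.exists_kernelIntegral_eqn H HΦ hf hfc hs0 z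
  obtain ⟨L₂, hL₂, hder₂⟩ := hq.exists_kernelIntegral_eqn H HΦ hf hfc hs0 z
  have hspace : L₁ - L₂ ≤ 0 := by
    refine le_of_tendsto (hL₁.sub hL₂) ?_
    filter_upwards [self_mem_nhdsWithin] with ε hε
    rw [Leps, Leps, ← integral_sub (hp.integrableOn_jump_kernelIntegral H hf hfc hs0 z hε)
      (hq.integrableOn_jump_kernelIntegral H hf hfc hs0 z hε)]
    refine setIntegral_nonpos (measurableSet_lt measurable_const measurable_norm) fun v hv => ?_
    have hv0 : 0 < ‖v‖ := lt_trans hε hv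
    have h1 : w s (z + v) - w s z ≤ 0 := by linarith [hglob s hs0 hst (z + v)]
    have h2 : 0 ≤ κ z v * J ‖v‖ :=
      mul_nonneg (H.κ₀_pos.le.trans (H.κ_low _ _)) (H.J_pos _ hv0).le
    have h3 := mul_nonpos_of_nonpos_of_nonneg h1 h2
    simp only [hw] at h3
    linarith
  have htime : η ≤ L₁ - L₂ := by
    have hder := (hder₁.sub hder₂).hasDerivWithinAt (s := Iio s)
    rw [hasDerivWithinAt_iff_tendsto_slope' self_notMem_Iio] at hder
    refine ge_of_tendsto hder ?_
    filter_upwards [Ioo_mem_nhdsLT hs0] with s' hs'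
    have := hglob s' hs'.1 (hs'.2.le.trans hst) z
    rw [slope_comm, slope_def_field, le_div_iff₀ (by linarith [hs'.2])]
    simp only [hw] at this
    simp only [Pi.sub_apply]
    linarith
  linarith

end GoodHeatKernel

end Kernel

/-- uniqueness of the good heat kernel for `L^κ`. -/
theorem heat_kernel_uniqueness
    (d : ℕ) (φ J : ℝ → ℝ) (a₁ α₁ C₀ a b β : ℝ)
    (κ : EuclideanSpace ℝ (Fin d) → EuclideanSpace ℝ (Fin d) → ℝ)
    (κ₀ κ₁ κ₂ δ : ℝ)
    (H : HKAssumptions d φ J a₁ α₁ C₀ a b β κ κ₀ κ₁ κ₂ δ)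
    (Φinv : ℝ → ℝ) (HΦ : PhiInvSpec φ Φinv)
    (p q : ℝ → EuclideanSpace ℝ (Fin d) → EuclideanSpace ℝ (Fin d) → ℝ)
    (hp : GoodHeatKernel d φ J b β Φinv κ p)
    (hq : GoodHeatKernel d φ J b β Φinv κ q) :
    ∀ t : ℝ, 0 < t → ∀ x y : EuclideanSpace ℝ (Fin d), p t x y = q t x y := by
  intro t ht x
  have hint : ∀ g : EuclideanSpace ℝ (Fin d) → ℝ, Continuous g → HasCompactSupport g →
      ∫ y, g y • (p t x y - q t x y) = 0 := fun g hg hgc => by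
    have heq := le_antisymm (hp.kernelIntegral_le hq H HΦ hg hgc ht x)
      (hq.kernelIntegral_le hp H HΦ hg hgc ht x)
    rw [kernelIntegral, kernelIntegral, ← sub_eq_zero, ← integral_sub
      (hp.integrable_mul hg hgc ht x) (hq.integrable_mul hg hgc ht x)] at heq
    rw [← heq]
    exact integral_congr_ae (.of_forall fun y => by simp only [smul_eq_mul]; ring)
  have hcont : Continuous fun y => p t x y - q t x y :=
    (hp.continuous_snd ht x).sub (hq.continuous_snd ht x)
  have hae : (fun y => p t x y - q t x y) =ᵐ[volume] fun _ => 0 :=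
    ae_eq_zero_of_integral_contDiff_smul_eq_zero hcont.locallyIntegrable
      fun g hg hgc => hint g hg.continuous hgc
  intro y
  exact sub_eq_zero.1 (congrFun ((hcont.ae_eq_iff_eq volume continuous_const).1 hae) y)
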